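/- arXiv:1909.09958 — 2 statements merged into one kernel-verified Lean document; each statement's English description precedes it below -/
import Mathlib

section
/- Let 0 < p ≤ 1 and let f, g belong to L₁(K₀(px)dx). Then for every τ ≥ 0 the Kontorovich–Lebedev transform of the convolution factorizes: F(f∗g)(τ) = (Ff)(τ)·(Fg)(τ). -/
open MeasureTheory Real Set

/-- `K_{iτ}(x) = ∫₀^∞ exp(−x cosh u) cos(τu) du`. -/
noncomputable def Kib (τ x : ℝ) : ℝ :=
  ∫ u in Ioi (0:ℝ), Real.exp (-x * Real.cosh u) * Real.cos (τ * u)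

/-- `K₀(x) = ∫₀^∞ exp(−x cosh u) du`. -/
noncomputable def K0 (x : ℝ) : ℝ := ∫ u in Ioi (0:ℝ), Real.exp (-x * Real.cosh u)

/-- The Kontorovich–Lebedev transform. -/
noncomputable def KL (f : ℝ → ℂ) (τ : ℝ) : ℂ := ∫ x in Ioi (0:ℝ), (Kib τ x : ℂ) * f x

/-- The Kontorovich–Lebedev convolution. -/
noncomputable def KLconv (f g : ℝ → ℂ) (x : ℝ) : ℂ :=
  (1/(2*x) : ℂ) * ∫ y in Ioi (0:ℝ), ∫ t in Ioi (0:ℝ),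
    (Real.exp (-((y^2+t^2)/(2*y*t))*x - y*t/(2*x)) : ℂ) * f y * g t

/-- The kernel `exp(−((y²+t²)/(2yt)) x − yt/(2x))` of the Kontorovich–Lebedev convolution. -/
noncomputable def macdonaldKernel (y t x : ℝ) : ℝ :=
  Real.exp (-((y^2+t^2)/(2*y*t))*x - y*t/(2*x))

/-- The integrand of the two-sided Fourier representation of `2 K_{iτ}(x)`. -/
noncomputable def fourierIntegrand (τ x u : ℝ) : ℂ :=
  (Real.exp (-x * Real.cosh u) : ℂ) * Complex.exp (Complex.I * (τ * u))

lemma macdonaldKernel_pos (y t x : ℝ) : 0 < macdonaldKernel y t x := Real.exp_pos _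

lemma Kib_zero (x : ℝ) : Kib 0 x = K0 x := by simp [Kib, K0]

lemma sq_div_four_le_cosh (u : ℝ) : u ^ 2 / 4 ≤ Real.cosh u := by
  rw [← Real.cosh_abs, Real.cosh_eq]
  have h1 := Real.quadratic_le_exp_of_nonneg (abs_nonneg u)
  have h2 := Real.exp_pos (-|u|)
  have h3 := abs_nonneg u
  rw [sq_abs] at h1
  linarith

lemma integrable_exp_neg_mul_cosh {x : ℝ} (hx : 0 < x) :
    Integrable (fun u : ℝ => Real.exp (-x * Real.cosh u)) := by
  refine (integrable_exp_neg_mul_sq (b := x / 4) (by positivity)).mono'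
    (by fun_prop) (ae_of_all _ fun u => ?_)
  rw [Real.norm_of_nonneg (Real.exp_pos _).le, Real.exp_le_exp]
  nlinarith [sq_div_four_le_cosh u]

lemma norm_fourierIntegrand (τ x u : ℝ) :
    ‖fourierIntegrand τ x u‖ = Real.exp (-x * Real.cosh u) := by
  rw [fourierIntegrand, norm_mul, Complex.norm_real, Real.norm_of_nonneg (Real.exp_pos _).le,
    mul_comm Complex.I, ← Complex.ofReal_mul, Complex.norm_exp_ofReal_mul_I, mul_one]

@[fun_prop]
lemma continuous_fourierIntegrand (τ x : ℝ) : Continuous (fourierIntegrand τ x) := by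
  unfold fourierIntegrand
  fun_prop

lemma integrable_fourierIntegrand (τ : ℝ) {x : ℝ} (hx : 0 < x) :
    Integrable (fourierIntegrand τ x) :=
  (integrable_exp_neg_mul_cosh hx).mono' (by fun_prop)
    (ae_of_all _ fun u => (norm_fourierIntegrand τ x u).le)

lemma integral_fourierIntegrand (τ : ℝ) {x : ℝ} (hx : 0 < x) :
    ∫ u, fourierIntegrand τ x u = 2 * (Kib τ x : ℂ) := by
  have hI := integrable_fourierIntegrand τ hx
  have hsum : (∫ u, fourierIntegrand τ x u) + ∫ u, fourierIntegrand τ x u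
      = ∫ u : ℝ, ((2 * (Real.exp (-x * Real.cosh |u|) * Real.cos (τ * |u|)) : ℝ) : ℂ) := by
    nth_rewrite 2 [← integral_neg_eq_self]
    rw [← integral_add hI hI.comp_neg]
    refine integral_congr_ae (ae_of_all _ fun u => ?_)
    have hc : Real.cos (τ * |u|) = Real.cos (τ * u) := by
      rcases abs_choice u with h | h <;> rw [h]
      rw [mul_neg, Real.cos_neg]
    simp only [fourierIntegrand, Real.cosh_neg, Real.cosh_abs, hc]
    push_cast
    rw [Complex.cos, show Complex.I * (↑τ * -(u:ℂ)) = -(↑τ * ↑u) * Complex.I by ring,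
      show Complex.I * (↑τ * (u:ℂ)) = (↑τ * ↑u) * Complex.I by ring]
    ring
  rw [integral_complex_ofReal, integral_const_mul,
    integral_comp_abs (f := fun u => Real.exp (-x * Real.cosh u) * Real.cos (τ * u))] at hsum
  change _ = ((2 * (2 * Kib τ x) : ℝ) : ℂ) at hsum
  push_cast at hsum
  linear_combination hsum / 2

lemma abs_Kib_le (τ : ℝ) {x : ℝ} (hx : 0 < x) : |Kib τ x| ≤ K0 x := by
  rw [← Real.norm_eq_abs, Kib, K0]
  refine norm_integral_le_of_norm_le (integrable_exp_neg_mul_cosh hx).integrableOn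
    (ae_of_all _ fun u => ?_)
  rw [norm_mul, Real.norm_of_nonneg (Real.exp_pos _).le]
  exact mul_le_of_le_one_right (Real.exp_pos _).le (Real.abs_cos_le_one _)

lemma K0_nonneg (x : ℝ) : 0 ≤ K0 x := integral_nonneg fun _ => (Real.exp_pos _).le

lemma K0_antitoneOn : AntitoneOn K0 (Ioi 0) := by
  intro a ha b hb hab
  refine integral_mono (integrable_exp_neg_mul_cosh hb).integrableOn
    (integrable_exp_neg_mul_cosh ha).integrableOn fun u => ?_
  exact Real.exp_le_exp.2 (by nlinarith [Real.cosh_pos u])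

lemma measurable_Kib (τ : ℝ) : Measurable (Kib τ) := by
  refine (StronglyMeasurable.integral_prod_right
    (f := fun x u => Real.exp (-x * Real.cosh u) * Real.cos (τ * u)) ?_).measurable
  exact Continuous.stronglyMeasurable (by fun_prop)

lemma measurable_K0 : Measurable K0 := by
  simpa only [← funext Kib_zero] using measurable_Kib 0

lemma exponent_change_of_variables {y t : ℝ} (hy : 0 < y) (ht : 0 < t) (s u : ℝ) {x : ℝ}
    (hx : x = y * t / (y + t * Real.exp (-s)) * Real.exp (-u)) :
    (-((y^2+t^2)/(2*y*t))*x - y*t/(2*x)) + -x * Real.cosh s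
      = -y * Real.cosh u + -t * Real.cosh (s - u) := by
  subst hx
  rw [Real.cosh_eq, Real.cosh_eq, Real.cosh_eq, neg_sub, Real.exp_sub, Real.exp_sub,
    Real.exp_neg, Real.exp_neg]
  have hU := Real.exp_pos u
  have hS := Real.exp_pos s
  generalize Real.exp u = U at *
  generalize Real.exp s = S at *
  have h : y * S + t ≠ 0 := by positivity
  field_simp
  ring

/-- Substituting `x = yt e^{-u} / (y + t e^{-s})` for `u` in the convolution of
`exp(−y cosh ·)` and `exp(−t cosh ·)`. -/
lemma macdonald_substitution {y t : ℝ} (hy : 0 < y) (ht : 0 < t) (s : ℝ) :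
    (IntegrableOn (fun x => x⁻¹ * macdonaldKernel y t x * Real.exp (-x * Real.cosh s)) (Ioi 0) ↔
      Integrable (fun u => Real.exp (-y * Real.cosh u) * Real.exp (-t * Real.cosh (s - u)))) ∧
    ∫ x in Ioi 0, x⁻¹ * macdonaldKernel y t x * Real.exp (-x * Real.cosh s) =
      ∫ u, Real.exp (-y * Real.cosh u) * Real.exp (-t * Real.cosh (s - u)) := by
  set c := y * t / (y + t * Real.exp (-s))
  have hc0 : 0 < c := by positivity
  have himage : (fun u => c * Real.exp (-u)) '' univ = Ioi 0 := by
    ext x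
    simp only [image_univ, mem_range, mem_Ioi]
    refine ⟨fun ⟨u, hu⟩ => hu ▸ by positivity, fun hx => ⟨-Real.log (x / c), ?_⟩⟩
    rw [neg_neg, Real.exp_log (by positivity)]
    field_simp
  have hderiv : ∀ u ∈ univ, HasDerivWithinAt (fun u => c * Real.exp (-u))
      (-(c * Real.exp (-u))) univ u := fun u _ => by
    simpa using ((hasDerivAt_id u).neg.exp).const_mul c
  have hinj : InjOn (fun u => c * Real.exp (-u)) univ := fun u _ v _ h =>
    neg_injective (Real.exp_injective (mul_left_cancel₀ hc0.ne' h))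
  have hcongr : ∀ u, |-(c * Real.exp (-u))| • ((c * Real.exp (-u))⁻¹ *
      macdonaldKernel y t (c * Real.exp (-u)) * Real.exp (-(c * Real.exp (-u)) * Real.cosh s)) =
      Real.exp (-y * Real.cosh u) * Real.exp (-t * Real.cosh (s - u)) := fun u => by
    have hx : 0 < c * Real.exp (-u) := by positivity
    rw [abs_neg, abs_of_pos hx, smul_eq_mul, mul_assoc (_⁻¹), mul_inv_cancel_left₀ hx.ne',
      macdonaldKernel, ← Real.exp_add, ← Real.exp_add,
      exponent_change_of_variables hy ht s u rfl]
  rw [← himage, integrableOn_image_iff_integrableOn_abs_deriv_smul .univ hderiv hinj,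
    integral_image_eq_integral_abs_deriv_smul .univ hderiv hinj]
  simp only [hcongr, integrableOn_univ, Measure.restrict_univ, and_true]

lemma fourierIntegrand_mul_fourierIntegrand_sub (τ y t s u : ℝ) :
    fourierIntegrand τ y u * fourierIntegrand τ t (s - u) =
      ((Real.exp (-y * Real.cosh u) * Real.exp (-t * Real.cosh (s - u)) : ℝ) : ℂ) *
        Complex.exp (Complex.I * (τ * s)) := by
  have h : Complex.exp (Complex.I * (τ * s)) =
      Complex.exp (Complex.I * (τ * u)) * Complex.exp (Complex.I * (τ * (s - u : ℝ))) := by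
    rw [← Complex.exp_add]
    congr 1
    push_cast
    ring
  rw [h, fourierIntegrand, fourierIntegrand]
  push_cast
  ring

lemma integrable_exp_cosh_mul_exp_cosh_sub {y t : ℝ} (hy : 0 < y) (ht : 0 < t) (s : ℝ) :
    Integrable (fun u => Real.exp (-y * Real.cosh u) * Real.exp (-t * Real.cosh (s - u))) := by
  refine (integrable_exp_neg_mul_cosh hy).mono' (by fun_prop) (ae_of_all _ fun u => ?_)
  rw [Real.norm_of_nonneg (by positivity)]
  refine mul_le_of_le_one_right (by positivity) (Real.exp_le_one_iff.2 ?_)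
  nlinarith [Real.cosh_pos (s - u)]

lemma measurable_macdonaldKernel :
    Measurable (fun q : ℝ × ℝ × ℝ => macdonaldKernel q.2.1 q.2.2 q.1) := by
  unfold macdonaldKernel
  fun_prop

lemma integrable_kernel_mul_fourierIntegrand (τ : ℝ) {y t : ℝ} (hy : 0 < y) (ht : 0 < t) :
    Integrable (fun q : ℝ × ℝ => ((q.2⁻¹ * macdonaldKernel y t q.2 : ℝ) : ℂ) *
      fourierIntegrand τ q.2 q.1) (volume.prod (volume.restrict (Ioi 0))) := by
  have hnorm : ∀ s : ℝ, ∀ x ∈ Ioi (0:ℝ), ‖((x⁻¹ * macdonaldKernel y t x : ℝ) : ℂ) *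
      fourierIntegrand τ x s‖ =
      x⁻¹ * macdonaldKernel y t x * Real.exp (-x * Real.cosh s) := fun s x hx => by
    rw [norm_mul, norm_fourierIntegrand, Complex.norm_real, Real.norm_of_nonneg]
    exact mul_nonneg (inv_nonneg.2 (le_of_lt hx)) (macdonaldKernel_pos y t x).le
  have hmeas : Measurable (fun q : ℝ × ℝ => ((q.2⁻¹ * macdonaldKernel y t q.2 : ℝ) : ℂ) *
      fourierIntegrand τ q.2 q.1) := by
    unfold fourierIntegrand macdonaldKernel
    fun_prop
  refine (integrable_prod_iff hmeas.aestronglyMeasurable).2 ⟨ae_of_all _ fun s => ?_, ?_⟩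
  · refine (integrable_norm_iff
      (hmeas.comp measurable_prodMk_left).aestronglyMeasurable).1 ?_
    exact (integrableOn_congr_fun (hnorm s) measurableSet_Ioi).2
      ((macdonald_substitution hy ht s).1.2 (integrable_exp_cosh_mul_exp_cosh_sub hy ht s))
  · have hconv := Integrable.integrable_convolution (ContinuousLinearMap.mul ℝ ℝ)
      (integrable_exp_neg_mul_cosh hy) (integrable_exp_neg_mul_cosh ht)
    refine hconv.congr (ae_of_all _ fun s => ?_)
    dsimp only
    rw [setIntegral_congr_fun measurableSet_Ioi (hnorm s), (macdonald_substitution hy ht s).2]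
    rfl

lemma integral_kernel_mul_fourierIntegrand (τ y t : ℝ) {x : ℝ} (hx : 0 < x) :
    ∫ s, ((x⁻¹ * macdonaldKernel y t x : ℝ) : ℂ) * fourierIntegrand τ x s =
      ((2 * (x⁻¹ * macdonaldKernel y t x * Kib τ x) : ℝ) : ℂ) := by
  rw [integral_const_mul, integral_fourierIntegrand τ hx]
  push_cast
  ring

lemma integrableOn_macdonaldKernel_mul_Kib (τ : ℝ) {y t : ℝ} (hy : 0 < y) (ht : 0 < t) :
    IntegrableOn (fun x => x⁻¹ * macdonaldKernel y t x * Kib τ x) (Ioi 0) := by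
  have h := (integrable_kernel_mul_fourierIntegrand τ hy ht).integral_prod_right
  have h2 : IntegrableOn (fun x => ((2 * (x⁻¹ * macdonaldKernel y t x * Kib τ x) : ℝ) : ℂ))
      (Ioi 0) :=
    (integrableOn_congr_fun (fun x hx => integral_kernel_mul_fourierIntegrand τ y t hx)
      measurableSet_Ioi).1 h
  refine (h2.re.const_mul (1 / 2)).congr (ae_of_all _ fun x => ?_)
  simp only [RCLike.re_to_complex, Complex.ofReal_re]
  ring

/-- **Macdonald's product formula** for the modified Bessel function of imaginary order. -/
lemma macdonald_product_formula (τ : ℝ) {y t : ℝ} (hy : 0 < y) (ht : 0 < t) :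
    ∫ x in Ioi 0, x⁻¹ * macdonaldKernel y t x * Kib τ x = 2 * (Kib τ y * Kib τ t) := by
  have hconv := integral_convolution (ContinuousLinearMap.mul ℂ ℂ)
    (integrable_fourierIntegrand τ hy) (integrable_fourierIntegrand τ ht)
  have hinner : ∀ s, convolution (fourierIntegrand τ y) (fourierIntegrand τ t)
      (ContinuousLinearMap.mul ℂ ℂ) volume s =
      ∫ x in Ioi 0, ((x⁻¹ * macdonaldKernel y t x : ℝ) : ℂ) * fourierIntegrand τ x s := by
    intro s
    simp only [convolution, ContinuousLinearMap.mul_apply',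
      fourierIntegrand_mul_fourierIntegrand_sub]
    rw [integral_mul_const, integral_complex_ofReal, ← (macdonald_substitution hy ht s).2,
      ← integral_complex_ofReal, ← integral_mul_const]
    refine integral_congr_ae (ae_of_all _ fun x => ?_)
    simp only [fourierIntegrand]
    push_cast
    ring
  simp only [hinner, ContinuousLinearMap.mul_apply', integral_fourierIntegrand τ hy,
    integral_fourierIntegrand τ ht] at hconv
  rw [integral_integral_swap (integrable_kernel_mul_fourierIntegrand τ hy ht),
    setIntegral_congr_fun measurableSet_Ioi
      (fun x hx => integral_kernel_mul_fourierIntegrand τ y t hx),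
    integral_complex_ofReal, integral_const_mul] at hconv
  have hreal : 2 * ∫ x in Ioi 0, x⁻¹ * macdonaldKernel y t x * Kib τ x =
      2 * Kib τ y * (2 * Kib τ t) := by
    exact_mod_cast hconv
  linarith

lemma integrableOn_K0_mul_norm {p : ℝ} (hp0 : 0 < p) (hp1 : p ≤ 1) {f : ℝ → ℂ}
    (hfm : Measurable f) (hf : IntegrableOn (fun x => K0 (p*x) * ‖f x‖) (Ioi 0)) :
    IntegrableOn (fun x => K0 x * ‖f x‖) (Ioi 0) := by
  refine hf.mono' (measurable_K0.mul hfm.norm).aestronglyMeasurable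
    ((ae_restrict_iff' measurableSet_Ioi).2 (ae_of_all _ fun x hx => ?_))
  rw [Real.norm_of_nonneg (mul_nonneg (K0_nonneg x) (norm_nonneg _))]
  have hx' : 0 < x := hx
  exact mul_le_mul_of_nonneg_right
    (K0_antitoneOn (mem_Ioi.2 (mul_pos hp0 hx')) hx (mul_le_of_le_one_left hx'.le hp1))
    (norm_nonneg _)

lemma ae_mem_quadrant : ∀ᵐ q : ℝ × ℝ ∂(volume.restrict (Ioi (0:ℝ))).prod
    (volume.restrict (Ioi (0:ℝ))), 0 < q.1 ∧ 0 < q.2 := by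
  rw [Measure.prod_restrict]
  exact (ae_restrict_iff' (measurableSet_Ioi.prod measurableSet_Ioi)).2
    (ae_of_all _ fun q hq => hq)

lemma integrable_KL_KLconv_integrand (τ : ℝ) {f g : ℝ → ℂ} (hfm : Measurable f)
    (hgm : Measurable g) (hf : IntegrableOn (fun x => K0 x * ‖f x‖) (Ioi 0))
    (hg : IntegrableOn (fun x => K0 x * ‖g x‖) (Ioi 0)) :
    Integrable (fun q : ℝ × ℝ × ℝ =>
      ((q.1⁻¹ * macdonaldKernel q.2.1 q.2.2 q.1 * Kib τ q.1 : ℝ) : ℂ) * (f q.2.1 * g q.2.2))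
      ((volume.restrict (Ioi 0)).prod
        ((volume.restrict (Ioi 0)).prod (volume.restrict (Ioi 0)))) := by
  have hK := measurable_Kib τ
  have hM := measurable_macdonaldKernel
  have hmeas : Measurable (fun q : ℝ × ℝ × ℝ =>
      ((q.1⁻¹ * macdonaldKernel q.2.1 q.2.2 q.1 * Kib τ q.1 : ℝ) : ℂ) *
        (f q.2.1 * g q.2.2)) := by
    fun_prop
  refine (integrable_prod_iff' hmeas.aestronglyMeasurable).2 ⟨?_, ?_⟩
  · filter_upwards [ae_mem_quadrant] with q hq
    exact (integrableOn_macdonaldKernel_mul_Kib τ hq.1 hq.2).ofReal.mul_const _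
  · refine ((hf.mul_prod hg).const_mul 2).mono'
      (hmeas.norm.stronglyMeasurable.integral_prod_left').aestronglyMeasurable ?_
    filter_upwards [ae_mem_quadrant] with q hq
    rw [Real.norm_of_nonneg (integral_nonneg fun _ => norm_nonneg _)]
    simp only [norm_mul, Complex.norm_real]
    rw [integral_mul_const]
    have hle : ∫ x in Ioi 0, ‖x⁻¹‖ * ‖macdonaldKernel q.1 q.2 x‖ * ‖Kib τ x‖ ≤
        2 * (K0 q.1 * K0 q.2) := by
      rw [← Kib_zero, ← Kib_zero, ← macdonald_product_formula 0 hq.1 hq.2]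
      refine setIntegral_mono_on ?_ (integrableOn_macdonaldKernel_mul_Kib 0 hq.1 hq.2)
        measurableSet_Ioi fun x hx => ?_
      · simpa only [IntegrableOn, norm_mul] using (integrableOn_macdonaldKernel_mul_Kib τ hq.1 hq.2).norm
      · have hx' : 0 < x⁻¹ := inv_pos.2 hx
        have hk := macdonaldKernel_pos q.1 q.2 x
        rw [Real.norm_of_nonneg hx'.le, Real.norm_of_nonneg hk.le, Kib_zero]
        exact mul_le_mul_of_nonneg_left (abs_Kib_le τ hx) (by positivity)
    calc _ ≤ 2 * (K0 q.1 * K0 q.2) * (‖f q.1‖ * ‖g q.2‖) := by gcongr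
      _ = _ := by ring

theorem KL_of_conv_eq_mul (p : ℝ) (hp0 : 0 < p) (hp1 : p ≤ 1) (f g : ℝ → ℂ)
    (hfm : Measurable f) (hgm : Measurable g)
    (hf : IntegrableOn (fun x => K0 (p*x) * ‖f x‖) (Ioi 0))
    (hg : IntegrableOn (fun x => K0 (p*x) * ‖g x‖) (Ioi 0)) :
    ∀ τ : ℝ, 0 ≤ τ → KL (KLconv f g) τ = KL f τ * KL g τ := by
  intro τ _
  have hI := integrable_KL_KLconv_integrand τ hfm hgm
    (integrableOn_K0_mul_norm hp0 hp1 hfm hf) (integrableOn_K0_mul_norm hp0 hp1 hgm hg)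
  have hleft : KL (KLconv f g) τ = ∫ x in Ioi 0, (1 / 2 : ℂ) *
      ∫ q, ((x⁻¹ * macdonaldKernel q.1 q.2 x * Kib τ x : ℝ) : ℂ) * (f q.1 * g q.2)
        ∂(volume.restrict (Ioi (0:ℝ))).prod (volume.restrict (Ioi (0:ℝ))) := by
    refine integral_congr_ae ?_
    filter_upwards [hI.prod_right_ae] with x hx
    rw [integral_prod _ hx, KLconv, ← mul_assoc]
    simp only [← integral_const_mul]
    refine integral_congr_ae (ae_of_all _ fun y => integral_congr_ae (ae_of_all _ fun t => ?_))
    simp only [macdonaldKernel]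
    push_cast
    ring
  have hright : ∀ᵐ q ∂(volume.restrict (Ioi (0:ℝ))).prod (volume.restrict (Ioi (0:ℝ))),
      ∫ x in Ioi 0, ((x⁻¹ * macdonaldKernel q.1 q.2 x * Kib τ x : ℝ) : ℂ) * (f q.1 * g q.2) =
        2 * ((Kib τ q.1 * f q.1) * (Kib τ q.2 * g q.2)) := by
    filter_upwards [ae_mem_quadrant] with q hq
    rw [integral_mul_const, integral_complex_ofReal, macdonald_product_formula τ hq.1 hq.2]
    push_cast
    ring
  rw [hleft, integral_const_mul, integral_integral_swap hI, integral_congr_ae hright,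
    integral_const_mul, integral_prod_mul (fun y => (Kib τ y : ℂ) * f y)
      (fun t => (Kib τ t : ℂ) * g t), KL, KL]
  ring
end

section
/- Let p ∈ (0,1), r > 1, a > 1, and let f : (0,∞) → ℂ be measurable with ∫₀^∞ K₀(px)·|f(x)|·x⁻¹ dx < ∞ and ∫₀^∞ K₀(px)·|f(x)|^r·x^{−a} dx < ∞, and set g(x) = f(x)/x. Then for every τ > 0, (Fg)(τ) = (1/τ) ∫₀^∞ sin(τu)·sinh(u) · (∫₀^∞ exp(−x·cosh u)·f(x) dx) du. -/
open MeasureTheory Real Set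

open Filter Topology

theorem integrableOn_exp_neg_mul_cosh {x : ℝ} (hx : 0 < x) :
    IntegrableOn (fun u => Real.exp (-x * Real.cosh u)) (Ioi 0) := by
  refine Integrable.mono' (integrableOn_exp_mul_Ioi (neg_lt_zero.2 hx) 0)
    (by fun_prop) ?_
  filter_upwards [ae_restrict_mem measurableSet_Ioi] with u hu
  rw [Real.norm_of_nonneg (Real.exp_pos _).le]
  have h : u ≤ Real.cosh u :=
    (Real.self_le_sinh_iff.2 (le_of_lt hu)).trans (Real.sinh_lt_cosh u).le
  exact Real.exp_le_exp.2 (by nlinarith)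

theorem tendsto_exp_neg_mul_cosh {x : ℝ} (hx : 0 < x) :
    Tendsto (fun u => Real.exp (-x * Real.cosh u)) atTop (𝓝 0) := by
  refine Real.tendsto_exp_atBot.comp (Tendsto.const_mul_atTop_of_neg (neg_lt_zero.2 hx) ?_)
  refine tendsto_atTop_mono' _ ?_ tendsto_id
  filter_upwards [eventually_ge_atTop 0] with u hu
  exact (Real.self_le_sinh_iff.2 hu).trans (Real.sinh_lt_cosh u).le

theorem hasDerivAt_exp_neg_mul_cosh (x u : ℝ) :
    HasDerivAt (fun u => Real.exp (-x * Real.cosh u))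
      (-x * (Real.sinh u * Real.exp (-x * Real.cosh u))) u := by
  exact ((Real.hasDerivAt_cosh u).const_mul (-x)).exp.congr_deriv (by ring)

theorem hasDerivAt_neg_exp_neg_mul_cosh_div {x : ℝ} (hx : 0 < x) (u : ℝ) :
    HasDerivAt (fun u => -Real.exp (-x * Real.cosh u) / x)
      (Real.sinh u * Real.exp (-x * Real.cosh u)) u := by
  refine ((hasDerivAt_exp_neg_mul_cosh x u).neg.div_const x).congr_deriv ?_
  rw [neg_mul, neg_neg, mul_div_cancel_left₀ _ hx.ne']

theorem tendsto_neg_exp_neg_mul_cosh_div {x : ℝ} (hx : 0 < x) :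
    Tendsto (fun u => -Real.exp (-x * Real.cosh u) / x) atTop (𝓝 0) := by
  simpa using (tendsto_exp_neg_mul_cosh hx).neg.div_const x

theorem sinh_mul_exp_nonneg (x : ℝ) {u : ℝ} (hu : u ∈ Ioi (0 : ℝ)) :
    0 ≤ Real.sinh u * Real.exp (-x * Real.cosh u) :=
  mul_nonneg (Real.sinh_nonneg_iff.2 (le_of_lt hu)) (Real.exp_pos _).le

theorem integrableOn_sinh_mul_exp_neg_mul_cosh {x : ℝ} (hx : 0 < x) :
    IntegrableOn (fun u => Real.sinh u * Real.exp (-x * Real.cosh u)) (Ioi 0) :=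
  integrableOn_Ioi_deriv_of_nonneg' (fun u _ => hasDerivAt_neg_exp_neg_mul_cosh_div hx u)
    (fun _ => sinh_mul_exp_nonneg x) (tendsto_neg_exp_neg_mul_cosh_div hx)

theorem integral_sinh_mul_exp_neg_mul_cosh {x : ℝ} (hx : 0 < x) :
    ∫ u in Ioi (0 : ℝ), Real.sinh u * Real.exp (-x * Real.cosh u) = Real.exp (-x) / x := by
  rw [integral_Ioi_of_hasDerivAt_of_nonneg' (fun u _ => hasDerivAt_neg_exp_neg_mul_cosh_div hx u)
    (fun _ => sinh_mul_exp_nonneg x) (tendsto_neg_exp_neg_mul_cosh_div hx)]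
  simp [neg_div]

theorem integrableOn_sin_mul_sinh_mul_exp (τ : ℝ) {x : ℝ} (hx : 0 < x) :
    IntegrableOn (fun u => Real.sin (τ * u) * Real.sinh u * Real.exp (-x * Real.cosh u))
      (Ioi 0) := by
  simp only [mul_assoc]
  exact (integrableOn_sinh_mul_exp_neg_mul_cosh hx).bdd_mul (c := 1) (by fun_prop)
    (ae_of_all _ fun u => Real.abs_sin_le_one _)

/-- Integration by parts in the integral defining `K_{iτ}`. -/
theorem Kib_eq_integral_sin_mul_sinh {τ x : ℝ} (hτ : τ ≠ 0) (hx : 0 < x) :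
    Kib τ x = x / τ *
      ∫ u in Ioi (0 : ℝ), Real.sin (τ * u) * Real.sinh u * Real.exp (-x * Real.cosh u) := by
  have hcos : IntegrableOn (fun u => Real.exp (-x * Real.cosh u) * Real.cos (τ * u)) (Ioi 0) :=
    (integrableOn_exp_neg_mul_cosh hx).mul_bdd (c := 1) (by fun_prop)
      (ae_of_all _ fun u => Real.abs_cos_le_one _)
  have hsin := (integrableOn_sin_mul_sinh_mul_exp τ hx).const_mul (x / τ)
  have hderiv (u : ℝ) : HasDerivAt (fun u => Real.exp (-x * Real.cosh u) * (Real.sin (τ * u) / τ))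
      (Real.exp (-x * Real.cosh u) * Real.cos (τ * u) -
        x / τ * (Real.sin (τ * u) * Real.sinh u * Real.exp (-x * Real.cosh u))) u := by
    refine ((hasDerivAt_exp_neg_mul_cosh x u).mul
      (((hasDerivAt_id' u).const_mul τ).sin.div_const τ)).congr_deriv ?_
    field_simp
    ring
  have hlim : Tendsto (fun u => Real.exp (-x * Real.cosh u) * (Real.sin (τ * u) / τ))
      atTop (𝓝 0) := by
    have hdiv := (tendsto_exp_neg_mul_cosh hx).div_const τ
    rw [zero_div] at hdiv
    refine (hdiv.zero_mul_isBoundedUnder_le (g := fun u => Real.sin (τ * u)) ?_).congr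
      fun u => by ring
    exact isBoundedUnder_of ⟨1, fun u => Real.abs_sin_le_one _⟩
  have h := integral_Ioi_of_hasDerivAt_of_tendsto' (fun u _ => hderiv u) (hcos.sub hsin) hlim
  rw [integral_sub hcos hsin, integral_const_mul] at h
  simp only [mul_zero, Real.sin_zero, zero_div, sub_zero] at h
  exact sub_eq_zero.1 h

theorem exists_exp_neg_le_mul_K0 {p : ℝ} (hp0 : 0 < p) (hp1 : p < 1) :
    ∃ C : ℝ, ∀ x : ℝ, 0 < x → Real.exp (-x) ≤ C * K0 (p * x) := by
  set c := Real.arcosh p⁻¹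
  have hc : 0 < c := Real.arcosh_pos ((one_lt_inv₀ hp0).2 hp1)
  have hcosh : Real.cosh c = p⁻¹ := Real.cosh_arcosh ((one_lt_inv₀ hp0).2 hp1).le
  refine ⟨c⁻¹, fun x hx => ?_⟩
  rw [inv_mul_eq_div, le_div_iff₀ hc]
  have hint := integrableOn_exp_neg_mul_cosh (mul_pos hp0 hx)
  calc Real.exp (-x) * c = ∫ _ in Ioc 0 c, Real.exp (-x) := by
        simp [hc.le, mul_comm]
    _ ≤ ∫ u in Ioc 0 c, Real.exp (-(p * x) * Real.cosh u) := by
        refine setIntegral_mono_on (by simp) (hint.mono_set Ioc_subset_Ioi_self)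
          measurableSet_Ioc fun u hu => Real.exp_le_exp.2 ?_
        have hle : Real.cosh u ≤ p⁻¹ := by
          rw [← hcosh, Real.cosh_le_cosh, abs_of_pos hu.1, abs_of_pos hc]
          exact hu.2
        have hmul : p * Real.cosh u ≤ 1 := by
          simpa [hp0.ne'] using mul_le_mul_of_nonneg_left hle hp0.le
        nlinarith
    _ ≤ K0 (p * x) :=
        setIntegral_mono_set hint (ae_of_all _ fun u => (Real.exp_pos _).le)
          Ioc_subset_Ioi_self.eventuallyLE

theorem integrableOn_exp_neg_div_mul_norm {p : ℝ} (hp0 : 0 < p) (hp1 : p < 1) {f : ℝ → ℂ}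
    (hfm : Measurable f) (hf : IntegrableOn (fun x => K0 (p * x) * ‖f x‖ / x) (Ioi 0)) :
    IntegrableOn (fun x => Real.exp (-x) / x * ‖f x‖) (Ioi 0) := by
  obtain ⟨C, hC⟩ := exists_exp_neg_le_mul_K0 hp0 hp1
  refine Integrable.mono' (hf.const_mul C) (by fun_prop) ?_
  filter_upwards [ae_restrict_mem measurableSet_Ioi] with x hx
  have hx : 0 < x := hx
  rw [Real.norm_of_nonneg (by positivity)]
  calc Real.exp (-x) / x * ‖f x‖ = Real.exp (-x) * (‖f x‖ / x) := by ring
    _ ≤ C * K0 (p * x) * (‖f x‖ / x) := by gcongr; exact hC x hx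
    _ = C * (K0 (p * x) * ‖f x‖ / x) := by ring

theorem integrable_prod_sin_mul_sinh_mul_exp (τ : ℝ) {f : ℝ → ℂ} (hfm : Measurable f)
    (hf : IntegrableOn (fun x => Real.exp (-x) / x * ‖f x‖) (Ioi 0)) :
    Integrable (fun z : ℝ × ℝ =>
      ((Real.sin (τ * z.2) * Real.sinh z.2 * Real.exp (-z.1 * Real.cosh z.2) : ℝ) : ℂ) * f z.1)
      ((volume.restrict (Ioi 0)).prod (volume.restrict (Ioi 0))) := by
  have hmeas : AEStronglyMeasurable (fun z : ℝ × ℝ =>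
      ((Real.sin (τ * z.2) * Real.sinh z.2 * Real.exp (-z.1 * Real.cosh z.2) : ℝ) : ℂ) * f z.1)
      ((volume.restrict (Ioi 0)).prod (volume.restrict (Ioi 0))) :=
    Measurable.aestronglyMeasurable (by fun_prop)
  rw [integrable_prod_iff hmeas]
  constructor
  · filter_upwards [ae_restrict_mem measurableSet_Ioi] with x hx
    exact (integrableOn_sin_mul_sinh_mul_exp τ hx).ofReal.mul_const _
  · refine Integrable.mono' hf hmeas.norm.integral_prod_right' ?_
    filter_upwards [ae_restrict_mem measurableSet_Ioi] with x hx
    rw [Real.norm_of_nonneg (integral_nonneg fun _ => norm_nonneg _)]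
    simp only [norm_mul, Complex.norm_real]
    rw [integral_mul_const, ← integral_sinh_mul_exp_neg_mul_cosh hx]
    refine mul_le_mul_of_nonneg_right ?_ (norm_nonneg _)
    refine integral_mono_of_nonneg (ae_of_all _ fun _ => by positivity)
      (integrableOn_sinh_mul_exp_neg_mul_cosh hx) ?_
    filter_upwards [ae_restrict_mem measurableSet_Ioi] with u hu
    have hsinh : 0 ≤ Real.sinh u := Real.sinh_nonneg_iff.2 (le_of_lt hu)
    rw [mul_assoc, Real.norm_of_nonneg hsinh, Real.norm_of_nonneg (Real.exp_pos _).le]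
    exact mul_le_of_le_one_left (sinh_mul_exp_nonneg x hu) (Real.abs_sin_le_one _)

theorem KL_eq_sin_form (p r a : ℝ) (hp0 : 0 < p) (hp1 : p < 1) (hr : 1 < r) (ha : 1 < a)
    (f : ℝ → ℂ) (hfm : Measurable f)
    (hf : IntegrableOn (fun x => K0 (p*x) * ‖f x‖ / x) (Ioi 0))
    (hfr : IntegrableOn (fun x => K0 (p*x) * ‖f x‖ ^ r / x ^ a) (Ioi 0)) :
    ∀ τ : ℝ, 0 < τ →
      KL (fun x => f x / x) τ =
        ((1/τ : ℝ) : ℂ) * ∫ u in Ioi (0:ℝ), ((Real.sin (τ*u) * Real.sinh u : ℝ) : ℂ) *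
          ∫ x in Ioi (0:ℝ), (Real.exp (-x * Real.cosh u) : ℂ) * f x := by
  intro τ hτ
  have hswap := integral_integral_swap (f := fun x u =>
    ((Real.sin (τ * u) * Real.sinh u * Real.exp (-x * Real.cosh u) : ℝ) : ℂ) * f x)
    (integrable_prod_sin_mul_sinh_mul_exp τ hfm
    (integrableOn_exp_neg_div_mul_norm hp0 hp1 hfm hf))
  calc KL (fun x => f x / x) τ
      = ∫ x in Ioi (0 : ℝ), ((1 / τ : ℝ) : ℂ) * ∫ u in Ioi (0 : ℝ),
          ((Real.sin (τ * u) * Real.sinh u * Real.exp (-x * Real.cosh u) : ℝ) : ℂ) * f x := by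
        refine setIntegral_congr_fun measurableSet_Ioi fun x hx => ?_
        have hx0 : (x : ℂ) ≠ 0 := Complex.ofReal_ne_zero.2 (ne_of_gt hx)
        dsimp only
        rw [integral_mul_const, integral_complex_ofReal, Kib_eq_integral_sin_mul_sinh hτ.ne' hx]
        push_cast
        field_simp
    _ = _ := by
        rw [integral_const_mul, hswap]
        congr 1
        refine integral_congr_ae (ae_of_all _ fun u => ?_)
        dsimp only
        rw [← integral_const_mul]
        refine integral_congr_ae (ae_of_all _ fun x => ?_)
        push_cast
        ring
end
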